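/- Let U ⊂ ℝ be open, and let u : U × (c,d) → ℝ³ be a smooth map with |u(x,t)| = 1 for all (x,t) and satisfying ∂_t u = u × ∂_x²u. Then at every point, ∂_t∂_x²u = − u × ∂_t²u − 2⟨∂_t∂_x u, ∂_x u⟩ u − |∂_x u|² ∂_t u. -/

import Mathlib

open MeasureTheory Set

noncomputable section

abbrev E3 := EuclideanSpace ℝ (Fin 3)

/-- The cross product on `EuclideanSpace ℝ (Fin 3)`. -/
def cross3 (a b : E3) : E3 :=
  (WithLp.equiv 2 (Fin 3 → ℝ)).symm
    (crossProduct ((WithLp.equiv 2 (Fin 3 → ℝ)) a) ((WithLp.equiv 2 (Fin 3 → ℝ)) b))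

/-- Partial derivative in the space variable of `u = u x t`. -/
def pdx (u : ℝ → ℝ → E3) : ℝ → ℝ → E3 := fun x t => deriv (fun y => u y t) x

/-- Partial derivative in the time variable of `u = u x t`. -/
def pdt (u : ℝ → ℝ → E3) : ℝ → ℝ → E3 := fun x t => deriv (fun s => u x s) t

/-- `u` is a smooth solution of the 1-dimensional Schrödinger flow with Neumann
boundary conditions on `[0,1] × [0,T]`. -/
def IsSol (T : ℝ) (u : ℝ → ℝ → E3) : Prop :=
  ContDiff ℝ (⊤ : ℕ∞) (fun p : ℝ × ℝ => u p.1 p.2) ∧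
  (∀ x ∈ Icc (0:ℝ) 1, ∀ t ∈ Icc (0:ℝ) T, ‖u x t‖ = 1) ∧
  (∀ x ∈ Icc (0:ℝ) 1, ∀ t ∈ Icc (0:ℝ) T, pdt u x t = cross3 (u x t) (pdx (pdx u) x t)) ∧
  (∀ t ∈ Icc (0:ℝ) T, pdx u 0 t = 0 ∧ pdx u 1 t = 0)

/-- Squared `L²` norm on `[0,1]`. -/
def L2sq (f : ℝ → E3) : ℝ := ∫ x in (0:ℝ)..1, ‖f x‖ ^ 2

/-- Squared `H^k` Sobolev norm on `[0,1]`. -/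
def Hsq (k : ℕ) (f : ℝ → E3) : ℝ :=
  ∑ j ∈ Finset.range (k + 1), ∫ x in (0:ℝ)..1, ‖deriv^[j] f x‖ ^ 2

theorem isBilinearMap_cross3 : IsBilinearMap ℝ cross3 where
  add_left a b c := by simp [cross3]
  smul_left r a b := by simp [cross3]
  add_right a b c := by simp [cross3]
  smul_right r a b := by simp [cross3]

theorem cross3_self (a : E3) : cross3 a a = 0 := by
  simp [cross3]

/-- Lagrange's formula for the iterated cross product. -/
theorem cross3_cross3_self (a b : E3) :
    cross3 a (cross3 a b) = (inner ℝ a b : ℝ) • a - ‖a‖ ^ 2 • b := by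
  rw [EuclideanSpace.real_norm_sq_eq]
  ext i
  fin_cases i <;>
    simp [cross3, cross_apply, PiLp.inner_apply, Fin.sum_univ_three] <;> ring

theorem HasDerivAt.cross3 {f g : ℝ → E3} {f' g' : E3} {t : ℝ}
    (hf : HasDerivAt f f' t) (hg : HasDerivAt g g' t) :
    HasDerivAt (fun s => cross3 (f s) (g s)) (cross3 (f t) g' + cross3 f' (g t)) t :=
  isBilinearMap_cross3.toContinuousBilinearMap.hasDerivAt_of_bilinear
    (fun _ => hf) (fun _ => hg)

section PartialDerivatives

variable {v : ℝ → ℝ → E3} {s : Set (ℝ × ℝ)} {x t : ℝ}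

theorem hasDerivAt_fst_of_differentiableAt
    (hv : DifferentiableAt ℝ (fun p : ℝ × ℝ => v p.1 p.2) (x, t)) :
    HasDerivAt (fun y => v y t) (fderiv ℝ (fun p : ℝ × ℝ => v p.1 p.2) (x, t) (1, 0)) x :=
  HasFDerivAt.comp_hasDerivAt (l := fun p : ℝ × ℝ => v p.1 p.2) x hv.hasFDerivAt
    ((hasDerivAt_id x).prodMk (hasDerivAt_const x t))

theorem hasDerivAt_snd_of_differentiableAt
    (hv : DifferentiableAt ℝ (fun p : ℝ × ℝ => v p.1 p.2) (x, t)) :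
    HasDerivAt (fun r => v x r) (fderiv ℝ (fun p : ℝ × ℝ => v p.1 p.2) (x, t) (0, 1)) t :=
  HasFDerivAt.comp_hasDerivAt (l := fun p : ℝ × ℝ => v p.1 p.2) t hv.hasFDerivAt
    ((hasDerivAt_const t x).prodMk (hasDerivAt_id t))

theorem ContDiffOn.differentiableAt_uncurried (hs : IsOpen s)
    (hv : ContDiffOn ℝ (⊤ : ℕ∞) (fun p : ℝ × ℝ => v p.1 p.2) s) (h : (x, t) ∈ s) :
    DifferentiableAt ℝ (fun p : ℝ × ℝ => v p.1 p.2) (x, t) :=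
  (hv.contDiffAt (hs.mem_nhds h)).differentiableAt (by simp)

theorem ContDiffOn.hasDerivAt_pdx (hs : IsOpen s)
    (hv : ContDiffOn ℝ (⊤ : ℕ∞) (fun p : ℝ × ℝ => v p.1 p.2) s) (h : (x, t) ∈ s) :
    HasDerivAt (fun y => v y t) (pdx v x t) x :=
  (hasDerivAt_fst_of_differentiableAt
    (hv.differentiableAt_uncurried hs h)).differentiableAt.hasDerivAt

theorem ContDiffOn.hasDerivAt_pdt (hs : IsOpen s)
    (hv : ContDiffOn ℝ (⊤ : ℕ∞) (fun p : ℝ × ℝ => v p.1 p.2) s) (h : (x, t) ∈ s) :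
    HasDerivAt (fun r => v x r) (pdt v x t) t :=
  (hasDerivAt_snd_of_differentiableAt
    (hv.differentiableAt_uncurried hs h)).differentiableAt.hasDerivAt

theorem ContDiffOn.pdx (hs : IsOpen s)
    (hv : ContDiffOn ℝ (⊤ : ℕ∞) (fun p : ℝ × ℝ => v p.1 p.2) s) :
    ContDiffOn ℝ (⊤ : ℕ∞) (fun p : ℝ × ℝ => pdx v p.1 p.2) s :=
  ((hv.fderiv_of_isOpen hs (m := (⊤ : ℕ∞)) (by simp)).clm_apply contDiffOn_const).congr
    fun _ hp => (hasDerivAt_fst_of_differentiableAt (hv.differentiableAt_uncurried hs hp)).deriv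

theorem ContDiffOn.pdt (hs : IsOpen s)
    (hv : ContDiffOn ℝ (⊤ : ℕ∞) (fun p : ℝ × ℝ => v p.1 p.2) s) :
    ContDiffOn ℝ (⊤ : ℕ∞) (fun p : ℝ × ℝ => pdt v p.1 p.2) s :=
  ((hv.fderiv_of_isOpen hs (m := (⊤ : ℕ∞)) (by simp)).clm_apply contDiffOn_const).congr
    fun _ hp => (hasDerivAt_snd_of_differentiableAt (hv.differentiableAt_uncurried hs hp)).deriv

end PartialDerivatives

/-- The second derivative of a curve on the unit sphere has normal component minus the squared
speed. -/
theorem inner_second_deriv_of_norm_eq_one {U : Set ℝ} (hU : IsOpen U) {f f' : ℝ → E3}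
    (hf : ∀ y ∈ U, HasDerivAt f (f' y) y) (hn : ∀ y ∈ U, ‖f y‖ = 1)
    {x : ℝ} (hx : x ∈ U) {f'' : E3} (hf' : HasDerivAt f' f'' x) :
    (inner ℝ (f x) f'' : ℝ) = -‖f' x‖ ^ 2 := by
  have orth : ∀ y ∈ U, (inner ℝ (f y) (f' y) : ℝ) = 0 := fun y hy => by
    have hconst : (fun z => ‖f z‖ ^ 2) =ᶠ[nhds y] fun _ => (1 : ℝ) := by
      filter_upwards [hU.mem_nhds hy] with z hz
      simp [hn z hz]
    have h := (hf y hy).norm_sq.unique ((hasDerivAt_const y (1 : ℝ)).congr_of_eventuallyEq hconst)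
    linarith
  have hzero : (fun z => (inner ℝ (f z) (f' z) : ℝ)) =ᶠ[nhds x] fun _ => 0 := by
    filter_upwards [hU.mem_nhds hx] with z hz using orth z hz
  have h := ((hf x hx).inner ℝ hf').unique
    ((hasDerivAt_const x (0 : ℝ)).congr_of_eventuallyEq hzero)
  rw [real_inner_self_eq_norm_sq] at h
  linarith

theorem utxx_eq_of_schrodinger_flow
    (U : Set ℝ) (hU : IsOpen U) (c d : ℝ) (u : ℝ → ℝ → E3)
    (hsm : ContDiffOn ℝ (⊤ : ℕ∞) (fun p : ℝ × ℝ => u p.1 p.2) (U ×ˢ Ioo c d))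
    (hsph : ∀ x ∈ U, ∀ t ∈ Ioo c d, ‖u x t‖ = 1)
    (heq : ∀ x ∈ U, ∀ t ∈ Ioo c d, pdt u x t = cross3 (u x t) (pdx (pdx u) x t)) :
    ∀ x ∈ U, ∀ t ∈ Ioo c d,
      pdt (pdx (pdx u)) x t
        = -cross3 (u x t) (pdt (pdt u) x t)
          - (2 * (inner ℝ (pdt (pdx u) x t) (pdx u x t) : ℝ)) • u x t
          - ‖pdx u x t‖ ^ 2 • pdt u x t := by
  have hs : IsOpen (U ×ˢ Ioo c d) := hU.prod isOpen_Ioo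
  have hsx := hsm.pdx hs
  have hst := hsm.pdt hs
  have key : ∀ x ∈ U, ∀ t ∈ Ioo c d,
      pdx (pdx u) x t = -cross3 (u x t) (pdt u x t) - ‖pdx u x t‖ ^ 2 • u x t := by
    intro x hx t ht
    have h := inner_second_deriv_of_norm_eq_one hU
      (fun y hy => hsm.hasDerivAt_pdx hs (mk_mem_prod hy ht)) (fun y hy => hsph y hy t ht) hx
      (hsx.hasDerivAt_pdx hs (mk_mem_prod hx ht))
    rw [heq x hx t ht, cross3_cross3_self, h, hsph x hx t ht]
    module
  intro x hx t ht
  have hxt : (x, t) ∈ U ×ˢ Ioo c d := mk_mem_prod hx ht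
  have hu := hsm.hasDerivAt_pdt hs hxt
  have hrhs := ((hu.cross3 (hst.hasDerivAt_pdt hs hxt)).neg).sub
    ((hsx.hasDerivAt_pdt hs hxt).norm_sq.smul hu)
  have hev : (fun r => pdx (pdx u) x r) =ᶠ[nhds t]
      fun r => -cross3 (u x r) (pdt u x r) - ‖pdx u x r‖ ^ 2 • u x r := by
    filter_upwards [isOpen_Ioo.mem_nhds ht] with r hr using key x hx r hr
  refine (hrhs.congr_of_eventuallyEq hev).deriv.trans ?_
  rw [cross3_self, real_inner_comm]
  module

end
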